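/- There exist an absolute constant C > 0 and n₀ ∈ ℕ such that for all n ≥ n₀ the following holds. Let c = c(n) > 0 be the unique value with Pr_{g ∼ N(0,1)}[|g| ≤ c] = (1/2)^{1/n}, and let K = [−c, c]ⁿ ⊆ ℝⁿ be the origin-centered axis-aligned cube (a centrally symmetric convex body with vol(K) = 1/2), viewed as a ±1-valued function. Then its Hermite weight at levels 0, 1 and 2 satisfies W^{≤2}[K] ≤ C · (log n)²/n. -/

import Mathlib

open MeasureTheory ProbabilityTheory

/-- The standard Gaussian measure `N(0,1)ⁿ` on `ℝⁿ`. -/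
noncomputable def stdGaussian (n : ℕ) : Measure (EuclideanSpace ℝ (Fin n)) :=
  (Measure.pi fun _ : Fin n => gaussianReal 0 1).map
    (EuclideanSpace.equiv (Fin n) ℝ).symm

open Classical in
/-- The `±1`-valued function associated to a set `K`. -/
noncomputable def pmInd {n : ℕ} (K : Set (EuclideanSpace ℝ (Fin n)))
    (x : EuclideanSpace ℝ (Fin n)) : ℝ :=
  if x ∈ K then 1 else -1

/-- The normalized probabilists' Hermite polynomial `h_d(x) = He_d(x)/√(d!)`,
orthonormal with respect to `N(0,1)`. -/
noncomputable def normHermite (d : ℕ) (x : ℝ) : ℝ :=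
  (Polynomial.aeval x (Polynomial.hermite d)) / Real.sqrt (Nat.factorial d)

/-- The Hermite coefficient `f̃(S) = E_{g ∼ N(0,1)ⁿ}[f(g) · ∏ᵢ h_{Sᵢ}(gᵢ)]`. -/
noncomputable def hermiteCoeff (n : ℕ) (f : EuclideanSpace ℝ (Fin n) → ℝ)
    (S : Fin n → ℕ) : ℝ :=
  ∫ x, f x * ∏ i, normHermite (S i) (x i) ∂(stdGaussian n)

/-- The Hermite weight of `f` at level `j`: `W^{=j}[f] = Σ_{|S| = j} f̃(S)²`. -/
noncomputable def hermiteWeight (n : ℕ) (f : EuclideanSpace ℝ (Fin n) → ℝ)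
    (j : ℕ) : ℝ :=
  ∑' S : {S : Fin n → ℕ // ∑ i, S i = j}, (hermiteCoeff n f S.1) ^ 2

lemma integrable_pow_gaussianReal (m : ℝ) (v : NNReal) (k : ℕ) :
    Integrable (fun x : ℝ => x ^ k) (gaussianReal m v) := by
  have h := (memLp_id_gaussianReal (μ := m) (v := v) k).integrable_norm_pow'
  refine h.mono (by fun_prop) (Filter.Eventually.of_forall fun x => ?_)
  simp

lemma integrable_aeval_gaussianReal (m : ℝ) (v : NNReal) (p : Polynomial ℤ) :
    Integrable (fun x : ℝ => Polynomial.aeval x p) (gaussianReal m v) := by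
  simp only [Polynomial.aeval_eq_sum_range]
  refine integrable_finsetSum _ fun k _ => ?_
  simpa using (integrable_pow_gaussianReal m v k).const_mul (p.coeff k : ℝ)

lemma integrable_normHermite (d : ℕ) : Integrable (normHermite d) (gaussianReal 0 1) :=
  (integrable_aeval_gaussianReal 0 1 _).div_const _

lemma normHermite_zero (x : ℝ) : normHermite 0 x = 1 := by
  simp [normHermite]

lemma normHermite_one (x : ℝ) : normHermite 1 x = x := by
  simp [normHermite]

lemma normHermite_two (x : ℝ) : normHermite 2 x = (x ^ 2 - 1) / √2 := by
  simp [normHermite, Polynomial.hermite_succ, pow_two]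

lemma measurableSet_abs_le (c : ℝ) : MeasurableSet {x : ℝ | |x| ≤ c} :=
  measurableSet_le (by fun_prop) (by fun_prop)

/-- The Hermite coefficients of a cube factor over the coordinates. -/
lemma hermiteCoeff_cube (n : ℕ) (c : ℝ) (S : Fin n → ℕ) :
    hermiteCoeff n (pmInd {x : EuclideanSpace ℝ (Fin n) | ∀ i, |x i| ≤ c}) S =
      2 * ∏ i, ∫ x in {x : ℝ | |x| ≤ c}, normHermite (S i) x ∂gaussianReal 0 1
        - ∏ i, ∫ x, normHermite (S i) x ∂gaussianReal 0 1 := by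
  classical
  have hind : ∀ i, Integrable ({x : ℝ | |x| ≤ c}.indicator (normHermite (S i)))
      (gaussianReal 0 1) := fun i =>
    (integrable_normHermite (S i)).indicator (measurableSet_abs_le c)
  have hemb : MeasurableEmbedding (EuclideanSpace.equiv (Fin n) ℝ).symm :=
    (EuclideanSpace.equiv (Fin n) ℝ).symm.toHomeomorph.measurableEmbedding
  have hpt : ∀ y : Fin n → ℝ,
      pmInd {x : EuclideanSpace ℝ (Fin n) | ∀ i, |x i| ≤ c}
          ((EuclideanSpace.equiv (Fin n) ℝ).symm y) *
        ∏ i, normHermite (S i) ((EuclideanSpace.equiv (Fin n) ℝ).symm y i) =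
      2 * ∏ i, {x : ℝ | |x| ≤ c}.indicator (normHermite (S i)) (y i)
        - ∏ i, normHermite (S i) (y i) := by
    intro y
    by_cases h : ∀ i, |y i| ≤ c
    · have h1 : ∀ i, {x : ℝ | |x| ≤ c}.indicator (normHermite (S i)) (y i) =
          normHermite (S i) (y i) := fun i =>
        Set.indicator_of_mem (s := {x : ℝ | |x| ≤ c}) (h i) _
      simp only [h1]
      simp [pmInd, h]
      ring
    · obtain ⟨i, hi⟩ := not_forall.1 h
      have h1 : ∏ i, {x : ℝ | |x| ≤ c}.indicator (normHermite (S i)) (y i) = 0 :=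
        Finset.prod_eq_zero (Finset.mem_univ i)
          (Set.indicator_of_notMem (s := {x : ℝ | |x| ≤ c}) hi _)
      rw [h1]
      simp [pmInd, h]
  rw [hermiteCoeff, _root_.stdGaussian, hemb.integral_map]
  simp only [hpt]
  rw [integral_sub ((Integrable.fintype_prod hind).const_mul 2)
      (Integrable.fintype_prod fun i => integrable_normHermite (S i)),
    integral_const_mul, integral_fintype_prod_eq_prod, integral_fintype_prod_eq_prod]
  simp only [integral_indicator (measurableSet_abs_le c)]

lemma setIntegral_id_abs_le_gaussianReal (v : NNReal) (c : ℝ) :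
    ∫ x in {x : ℝ | |x| ≤ c}, x ∂gaussianReal 0 v = 0 := by
  have hmap : (gaussianReal 0 v).map (fun x => -x) = gaussianReal 0 v := by
    rw [gaussianReal_map_neg, neg_zero]
  have hemb : MeasurableEmbedding fun x : ℝ => -x :=
    (MeasurableEquiv.neg ℝ).measurableEmbedding
  have h : ∫ x, {x : ℝ | |x| ≤ c}.indicator (fun x => x) x ∂gaussianReal 0 v =
      - ∫ x, {x : ℝ | |x| ≤ c}.indicator (fun x => x) x ∂gaussianReal 0 v := by
    conv_lhs => rw [← hmap, hemb.integral_map]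
    rw [← integral_neg]
    refine integral_congr_ae (Filter.Eventually.of_forall fun x => ?_)
    simp only [Set.indicator_apply, Set.mem_ofPred_eq, abs_neg]
    split_ifs <;> simp
  rw [← integral_indicator (measurableSet_abs_le c)]
  linarith

lemma integral_sq_gaussianReal_zero_one : ∫ x, x ^ 2 ∂gaussianReal 0 1 = 1 := by
  have h := variance_eq_sub (memLp_id_gaussianReal (μ := 0) (v := 1) 2)
  rw [variance_id_gaussianReal] at h
  simpa using h.symm

lemma hermiteCoeff_cube_eq_zero (n : ℕ) (c : ℝ) (S : Fin n → ℕ) (i : Fin n) (hi : S i = 1) :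
    hermiteCoeff n (pmInd {x : EuclideanSpace ℝ (Fin n) | ∀ i, |x i| ≤ c}) S = 0 := by
  rw [hermiteCoeff_cube, Finset.prod_eq_zero (Finset.mem_univ i),
    Finset.prod_eq_zero (Finset.mem_univ i)]
  · simp
  · simp [hi, normHermite_one]
  · simp [hi, normHermite_one, setIntegral_id_abs_le_gaussianReal]

/-- A Gaussian tail set of small measure carries little second moment. -/
lemma exists_setIntegral_sq_le (μ : Measure ℝ) [IsGaussian μ] :
    ∃ L : ℝ, 0 < L ∧ ∀ A : Set ℝ, MeasurableSet A → ∀ N : ℝ, Real.exp 1 ≤ N →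
      μ.real A ≤ 1 / N → ∫ x in A, x ^ 2 ∂μ ≤ L * Real.log N / N := by
  obtain ⟨δ, hδ, hint⟩ := IsGaussian.exists_integrable_exp_sq μ
  have hM : 0 ≤ ∫ x, Real.exp (δ * ‖x‖ ^ 2) ∂μ := integral_nonneg fun x => (Real.exp_pos _).le
  set M := ∫ x, Real.exp (δ * ‖x‖ ^ 2) ∂μ with hMdef
  refine ⟨(1 + M) / δ, by positivity, fun A hA N hN hAN => ?_⟩
  have hN0 : 0 < N := (Real.exp_pos 1).trans_le hN
  have hlog : 1 ≤ Real.log N := (Real.le_log_iff_exp_le hN0).2 hN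
  have hpt : ∀ x : ℝ, x ^ 2 ≤ Real.log N / δ + 1 / (δ * N) * Real.exp (δ * ‖x‖ ^ 2) := by
    intro x
    have h1 := Real.add_one_le_exp (δ * ‖x‖ ^ 2 - Real.log N)
    rw [Real.exp_sub, Real.exp_log hN0] at h1
    have h2 : Real.log N / δ + 1 / (δ * N) * Real.exp (δ * ‖x‖ ^ 2) =
        (Real.log N + Real.exp (δ * ‖x‖ ^ 2) / N) / δ := by field_simp
    rw [h2, le_div_iff₀ hδ]
    rw [Real.norm_eq_abs, sq_abs] at h1 ⊢
    linarith
  have hI : Integrable (fun x : ℝ => Real.exp (δ * ‖x‖ ^ 2)) (μ.restrict A) := hint.restrict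
  have hsum : Integrable (fun x : ℝ => Real.log N / δ + 1 / (δ * N) * Real.exp (δ * ‖x‖ ^ 2))
      (μ.restrict A) := (integrable_const _).add (hI.const_mul _)
  calc ∫ x in A, x ^ 2 ∂μ
      ≤ ∫ x in A, (Real.log N / δ + 1 / (δ * N) * Real.exp (δ * ‖x‖ ^ 2)) ∂μ :=
        integral_mono_of_nonneg (Filter.Eventually.of_forall fun x => sq_nonneg x) hsum
          (Filter.Eventually.of_forall hpt)
    _ = μ.real A * (Real.log N / δ)
          + 1 / (δ * N) * ∫ x in A, Real.exp (δ * ‖x‖ ^ 2) ∂μ := by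
        rw [integral_add (integrable_const _) (hI.const_mul _), integral_const_mul]
        simp
    _ ≤ 1 / N * (Real.log N / δ) + 1 / (δ * N) * (M * Real.log N) := by
        have h3 : ∫ x in A, Real.exp (δ * ‖x‖ ^ 2) ∂μ ≤ M :=
          setIntegral_le_integral hint (Filter.Eventually.of_forall fun x => (Real.exp_pos _).le)
        gcongr
        exact h3.trans (le_mul_of_one_le_right hM hlog)
    _ = (1 + M) / δ * Real.log N / N := by field_simp

lemma one_sub_inv_le_half_rpow {x : ℝ} (hx : 0 < x) : 1 - 1 / x ≤ (1 / 2 : ℝ) ^ x⁻¹ := by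
  have h := Real.add_one_le_exp (Real.log (1 / 2) * x⁻¹)
  rw [← Real.rpow_def_of_pos (by norm_num)] at h
  have h2 : -1 ≤ Real.log (1 / 2) := by
    rw [one_div, Real.log_inv]
    linarith [Real.log_two_lt_d9]
  have := mul_le_mul_of_nonneg_right h2 (inv_pos.2 hx).le
  rw [one_div]
  linarith

lemma exists_setIntegral_sq_sub_one_le :
    ∃ L : ℝ, 0 < L ∧ ∀ c N : ℝ, Real.exp 1 ≤ N →
      1 - 1 / N ≤ (gaussianReal 0 1).real {x : ℝ | |x| ≤ c} →
      |∫ x in {x : ℝ | |x| ≤ c}, (x ^ 2 - 1) ∂gaussianReal 0 1| ≤ L * Real.log N / N := by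
  obtain ⟨L, hL, h⟩ := exists_setIntegral_sq_le (gaussianReal 0 1)
  refine ⟨L + 1, by positivity, fun c N hN hc => ?_⟩
  have hN0 : 0 < N := (Real.exp_pos 1).trans_le hN
  have hlog : 1 ≤ Real.log N := (Real.le_log_iff_exp_le hN0).2 hN
  have hmeas := measurableSet_abs_le c
  have hcompl : (gaussianReal 0 1).real {x : ℝ | |x| ≤ c}ᶜ ≤ 1 / N := by
    rw [probReal_compl_eq_one_sub hmeas]
    linarith
  have hsq := h _ hmeas.compl N hN hcompl
  have hint : Integrable (fun x : ℝ => x ^ 2) (gaussianReal 0 1) :=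
    integrable_pow_gaussianReal 0 1 2
  have htot := integral_add_compl hmeas (hint.sub (integrable_const (1 : ℝ)))
  have htot0 : ∫ x, (x ^ 2 - 1) ∂gaussianReal 0 1 = 0 := by
    rw [integral_sub hint (integrable_const _), integral_sq_gaussianReal_zero_one]
    simp
  have hcomplint : ∫ x in {x : ℝ | |x| ≤ c}ᶜ, (x ^ 2 - 1) ∂gaussianReal 0 1 =
      ∫ x in {x : ℝ | |x| ≤ c}ᶜ, x ^ 2 ∂gaussianReal 0 1
        - (gaussianReal 0 1).real {x : ℝ | |x| ≤ c}ᶜ := by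
    rw [integral_sub hint.restrict (integrable_const _)]
    simp
  have h0 : 0 ≤ ∫ x in {x : ℝ | |x| ≤ c}ᶜ, x ^ 2 ∂gaussianReal 0 1 :=
    integral_nonneg fun x => sq_nonneg x
  have h1 : 0 ≤ (gaussianReal 0 1).real {x : ℝ | |x| ≤ c}ᶜ := measureReal_nonneg
  have h2 : 1 / N ≤ Real.log N / N := by gcongr
  have h3 : (L + 1) * Real.log N / N = L * Real.log N / N + Real.log N / N := by ring
  have h4 : 0 ≤ L * Real.log N / N := by positivity
  simp only [Pi.sub_apply] at htot
  rw [abs_le]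
  constructor <;> linarith

lemma exists_eq_single_two {ι : Type*} [Fintype ι] [DecidableEq ι] (S : ι → ℕ)
    (hS : ∑ i, S i = 2) (h1 : ∀ i, S i ≠ 1) : ∃ i, S = Pi.single i 2 := by
  obtain ⟨i, -, hi⟩ : ∃ i ∈ Finset.univ, S i ≠ 0 :=
    Finset.exists_ne_zero_of_sum_ne_zero (by omega)
  have hsum := Finset.add_sum_erase Finset.univ S (Finset.mem_univ i)
  have hi1 := h1 i
  have hz : ∑ j ∈ Finset.univ.erase i, S j = 0 := by omega
  refine ⟨i, funext fun j => ?_⟩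
  rcases eq_or_ne j i with rfl | hj
  · rw [Pi.single_eq_same]
    omega
  · rw [Pi.single_eq_of_ne hj]
    exact Finset.sum_eq_zero_iff.1 hz j (Finset.mem_erase.2 ⟨hj, Finset.mem_univ j⟩)

lemma sq_hermiteCoeff_cube_single_two_le (n : ℕ) (c : ℝ) (i : Fin n) :
    hermiteCoeff n (pmInd {x : EuclideanSpace ℝ (Fin n) | ∀ i, |x i| ≤ c}) (Pi.single i 2) ^ 2 ≤
      2 * (∫ x in {x : ℝ | |x| ≤ c}, (x ^ 2 - 1) ∂gaussianReal 0 1) ^ 2 := by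
  have hfull : ∫ x, normHermite 2 x ∂gaussianReal 0 1 = 0 := by
    simp only [normHermite_two]
    rw [integral_div, integral_sub (integrable_pow_gaussianReal 0 1 2) (integrable_const _),
      integral_sq_gaussianReal_zero_one]
    simp
  have hprod0 : ∏ j, ∫ x, normHermite ((Pi.single i 2 : Fin n → ℕ) j) x ∂gaussianReal 0 1 = 0 :=
    Finset.prod_eq_zero (Finset.mem_univ i) (by rw [Pi.single_eq_same, hfull])
  set a := ∫ x in {x : ℝ | |x| ≤ c}, (x ^ 2 - 1) ∂gaussianReal 0 1
  set q := ∏ j ∈ Finset.univ.erase i,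
    ∫ x in {x : ℝ | |x| ≤ c}, normHermite ((Pi.single i 2 : Fin n → ℕ) j) x ∂gaussianReal 0 1
    with hq
  have hq1 : q ^ 2 ≤ 1 := by
    have hterm : ∀ j ∈ Finset.univ.erase i, ∫ x in {x : ℝ | |x| ≤ c},
        normHermite ((Pi.single i 2 : Fin n → ℕ) j) x ∂gaussianReal 0 1 =
        (gaussianReal 0 1).real {x : ℝ | |x| ≤ c} := by
      intro j hj
      rw [Pi.single_eq_of_ne (Finset.ne_of_mem_erase hj)]
      simp [normHermite_zero]
    rw [hq, Finset.prod_congr rfl hterm, Finset.prod_const, ← pow_mul]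
    exact pow_le_one₀ measureReal_nonneg measureReal_le_one
  have ha : ∫ x in {x : ℝ | |x| ≤ c}, normHermite 2 x ∂gaussianReal 0 1 = a / √2 := by
    simp only [normHermite_two]
    rw [integral_div]
  rw [hermiteCoeff_cube, hprod0, ← Finset.mul_prod_erase _ _ (Finset.mem_univ i), ← hq,
    Pi.single_eq_same, ha, sub_zero, mul_pow, mul_pow, div_pow, Real.sq_sqrt (by norm_num)]
  nlinarith [mul_le_mul_of_nonneg_left hq1 (sq_nonneg a)]

lemma hermiteWeight_zero_cube (n : ℕ) (c : ℝ)
    (hc : (gaussianReal 0 1).real {x : ℝ | |x| ≤ c} ^ n = 1 / 2) :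
    hermiteWeight n (pmInd {x : EuclideanSpace ℝ (Fin n) | ∀ i, |x i| ≤ c}) 0 = 0 := by
  rw [hermiteWeight]
  refine (tsum_congr fun S => ?_).trans tsum_zero
  have hS : ∀ i, S.1 i = 0 := by simpa using S.2
  simp [hermiteCoeff_cube, hS, normHermite_zero, hc]

lemma hermiteWeight_one_cube (n : ℕ) (c : ℝ) :
    hermiteWeight n (pmInd {x : EuclideanSpace ℝ (Fin n) | ∀ i, |x i| ≤ c}) 1 = 0 := by
  rw [hermiteWeight]
  refine (tsum_congr fun S => ?_).trans tsum_zero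
  obtain ⟨i, -, hi⟩ : ∃ i ∈ Finset.univ, S.1 i ≠ 0 :=
    Finset.exists_ne_zero_of_sum_ne_zero (by rw [S.2]; exact one_ne_zero)
  have hle := Finset.single_le_sum (fun j _ => Nat.zero_le (S.1 j)) (Finset.mem_univ i)
  rw [S.2] at hle
  rw [hermiteCoeff_cube_eq_zero n c S.1 i (by omega)]
  simp

lemma hermiteWeight_two_cube_le (n : ℕ) (c : ℝ) :
    hermiteWeight n (pmInd {x : EuclideanSpace ℝ (Fin n) | ∀ i, |x i| ≤ c}) 2 ≤
      n * (2 * (∫ x in {x : ℝ | |x| ≤ c}, (x ^ 2 - 1) ∂gaussianReal 0 1) ^ 2) := by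
  let g : Fin n → {S : Fin n → ℕ // ∑ i, S i = 2} := fun i => ⟨Pi.single i 2, by simp⟩
  have hg : Function.Injective g := by
    intro i j hij
    by_contra hne
    have h := congrFun (congrArg Subtype.val hij) i
    simp [g, Pi.single_eq_of_ne hne] at h
  rw [hermiteWeight, ← hg.tsum_eq, tsum_fintype]
  · refine (Finset.sum_le_sum fun i _ => sq_hermiteCoeff_cube_single_two_le n c i).trans ?_
    simp
  · intro S hS
    have h1 : ∀ i, S.1 i ≠ 1 := fun i hi =>
      hS (by simp [hermiteCoeff_cube_eq_zero n c S.1 i hi])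
    obtain ⟨i, hi⟩ := exists_eq_single_two S.1 S.2 h1
    exact ⟨i, Subtype.ext hi.symm⟩

/-- The scaled origin-centered cube `[-c, c]ⁿ` with `Pr_{g∼N(0,1)}[|g| ≤ c] = (1/2)^{1/n}`
(so that its Gaussian volume is `1/2`) has Hermite weight at most `C·(log n)²/n` at
levels 0, 1 and 2 combined. -/
theorem cube_low_level_weight_upper_bound :
    ∃ C : ℝ, 0 < C ∧ ∃ n₀ : ℕ, ∀ n : ℕ, n₀ ≤ n →
      ∀ c : ℝ, 0 < c →
        gaussianReal 0 1 {x : ℝ | |x| ≤ c}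
          = ENNReal.ofReal ((1 / 2 : ℝ) ^ ((n : ℝ)⁻¹)) →
        hermiteWeight n (pmInd {x : EuclideanSpace ℝ (Fin n) | ∀ i, |x i| ≤ c}) 0
            + hermiteWeight n (pmInd {x : EuclideanSpace ℝ (Fin n) | ∀ i, |x i| ≤ c}) 1
            + hermiteWeight n (pmInd {x : EuclideanSpace ℝ (Fin n) | ∀ i, |x i| ≤ c}) 2
          ≤ C * (Real.log n) ^ 2 / n := by
  obtain ⟨L, hL, h⟩ := exists_setIntegral_sq_sub_one_le
  refine ⟨2 * L ^ 2, by positivity, 3, fun n hn c _ hc => ?_⟩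
  have hn0 : (0 : ℝ) < n := by
    have : 0 < n := by omega
    exact_mod_cast this
  have hexp : Real.exp 1 ≤ n := by
    have : (3 : ℝ) ≤ n := by exact_mod_cast hn
    linarith [Real.exp_one_lt_d9]
  have hreal : (gaussianReal 0 1).real {x : ℝ | |x| ≤ c} = (1 / 2 : ℝ) ^ ((n : ℝ)⁻¹) := by
    rw [measureReal_def, hc, ENNReal.toReal_ofReal (by positivity)]
  have hpow : (gaussianReal 0 1).real {x : ℝ | |x| ≤ c} ^ n = 1 / 2 := by
    rw [hreal, Real.rpow_inv_natCast_pow (by norm_num) (by omega)]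
  have hbound := h c n hexp (hreal ▸ one_sub_inv_le_half_rpow hn0)
  rw [hermiteWeight_zero_cube n c hpow, hermiteWeight_one_cube, zero_add, zero_add]
  refine (hermiteWeight_two_cube_le n c).trans ?_
  rw [← sq_abs (∫ x in {x : ℝ | |x| ≤ c}, (x ^ 2 - 1) ∂gaussianReal 0 1)]
  calc (n : ℝ) * (2 * |∫ x in {x : ℝ | |x| ≤ c}, (x ^ 2 - 1) ∂gaussianReal 0 1| ^ 2)
      ≤ n * (2 * (L * Real.log n / n) ^ 2) := by gcongr
    _ = 2 * L ^ 2 * Real.log n ^ 2 / n := by field_simp
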